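/- Let f : ℝ → ℝ be a smooth 2π-periodic function and n a positive integer such that for every i ≥ 0, the i-th derivative f⁽ⁱ⁾ has exactly 2n zeros in the period [0, 2π). Then f is a trigonometric polynomial: there exist m ≥ 0 and real numbers a₀, a₁, …, a_m, b₁, …, b_m such that f(x) = a₀ + Σ_{k=1}^{m} (aₖ cos kx + bₖ sin kx) for all x. -/

import Mathlib

open Set Real

open Filter Topology ComplexConjugate

/-- `g` takes strictly alternating signs at `N + 1` increasing points, the last of which is the
first one shifted by `2π`. -/
def AlternatesOnPeriod (N : ℕ) (g : ℝ → ℝ) : Prop :=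
  ∃ t : ℕ → ℝ, (∀ k < N, t k < t (k + 1)) ∧ t N = t 0 + 2 * π ∧
    ∀ k ≤ N, 0 < (-1) ^ k * g (t k)

theorem AlternatesOnPeriod.const_mul {N : ℕ} {g : ℝ → ℝ} (h : AlternatesOnPeriod N g) {c : ℝ}
    (hc : 0 < c) : AlternatesOnPeriod N (fun x => c * g x) := by
  obtain ⟨t, ht, hp, hs⟩ := h
  refine ⟨t, ht, hp, fun k hk => ?_⟩
  have := mul_pos hc (hs k hk)
  linarith

/-- If `e^{-lam x} g` drops between two points, then `lam g - g'` is positive in between. -/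
theorem exists_pos_const_mul_sub_deriv {g g' : ℝ → ℝ} (hg : ∀ x, HasDerivAt g (g' x) x) (lam : ℝ)
    {a b : ℝ} (hab : a < b) (ha : 0 < g a) (hb : g b < 0) :
    ∃ x ∈ Ioo a b, 0 < lam * g x - g' x := by
  have hd : ∀ x, HasDerivAt (fun x => rexp (-lam * x) * g x)
      (rexp (-lam * x) * (-lam * 1) * g x + rexp (-lam * x) * g' x) x := fun x =>
    (((hasDerivAt_id x).const_mul (-lam)).exp).mul (hg x)
  obtain ⟨x, hx, hxe⟩ := exists_hasDerivAt_eq_slope _ _ hab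
    (fun y _ => (hd y).continuousAt.continuousWithinAt) (fun y _ => hd y)
  refine ⟨x, hx, ?_⟩
  have hslope : (rexp (-lam * b) * g b - rexp (-lam * a) * g a) / (b - a) < 0 := by
    apply div_neg_of_neg_of_pos _ (sub_pos.2 hab)
    nlinarith [mul_pos (exp_pos (-lam * a)) ha, mul_pos (exp_pos (-lam * b)) (neg_pos.2 hb)]
  rw [← hxe] at hslope
  by_contra hneg
  nlinarith [mul_nonneg (exp_pos (-lam * x)).le (sub_nonneg.2 (not_lt.1 hneg))]

theorem AlternatesOnPeriod.const_mul_sub_deriv {N : ℕ} (hN : Even N) {g g' : ℝ → ℝ}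
    (hg : ∀ x, HasDerivAt g (g' x) x) (hper : Function.Periodic g (2 * π))
    (hper' : Function.Periodic g' (2 * π)) (lam : ℝ) (h : AlternatesOnPeriod N g) :
    AlternatesOnPeriod N (fun x => lam * g x - g' x) := by
  obtain ⟨t, ht, hp, hs⟩ := h
  have hN0 : 0 < N := by
    rcases Nat.eq_zero_or_pos N with rfl | h
    · linarith [pi_pos]
    · exact h
  have key : ∀ k < N, ∃ x ∈ Ioo (t k) (t (k + 1)), 0 < (-1) ^ k * (lam * g x - g' x) := by
    intro k hk
    obtain ⟨x, hx, hpos⟩ := exists_pos_const_mul_sub_deriv (g := fun x => (-1) ^ k * g x)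
      (g' := fun x => (-1) ^ k * g' x) (fun x => (hg x).const_mul _) lam (ht k hk) (hs k hk.le)
      (by have := hs (k + 1) hk; rw [pow_succ] at this; linarith)
    exact ⟨x, hx, by linarith⟩
  choose! s hs1 hs2 using key
  refine ⟨fun k => if k < N then s k else s 0 + 2 * π, fun k hk => ?_, by simp [hN0],
    fun k hk => ?_⟩
  · by_cases hk1 : k + 1 < N
    · simpa [hk, hk1] using (hs1 k hk).2.trans (hs1 (k + 1) hk1).1
    · have : k + 1 = N := by omega
      have h1 := (hs1 k hk).2
      rw [this, hp] at h1
      simp only [hk, hk1, if_true, if_false]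
      linarith [(hs1 0 hN0).1]
  · rcases hk.lt_or_eq with hk | rfl
    · simpa [hk] using hs2 k hk
    · have := hs2 0 hN0
      simpa [hper _, hper' _, hN.neg_one_pow] using this

theorem AlternatesOnPeriod.le_encard_zeros {N : ℕ} {g : ℝ → ℝ} (hg : Continuous g)
    (hper : Function.Periodic g (2 * π)) (h : AlternatesOnPeriod N g) :
    (N : ℕ∞) ≤ {x ∈ Ico (0 : ℝ) (2 * π) | g x = 0}.encard := by
  obtain ⟨t, ht, hp, hs⟩ := h
  have key : ∀ k < N, ∃ x ∈ Ioo (t k) (t (k + 1)), g x = 0 := by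
    intro k hk
    have h1 := hs k hk.le
    have h2 := hs (k + 1) hk
    rw [pow_succ] at h2
    obtain ⟨x, hx, hx0⟩ := intermediate_value_Ioo' (ht k hk).le
      (f := fun x => (-1) ^ k * g x) (by fun_prop) ⟨by linarith, h1⟩
    exact ⟨x, hx, by simpa using hx0⟩
  choose! s hs1 hs2 using key
  have hmono : ∀ k ≤ N, ∀ j ≤ k, t j ≤ t k := by
    intro k
    induction k with
    | zero => intro _ j hj; rw [Nat.le_zero.1 hj]
    | succ k ih =>
      intro hk j hj
      rcases Nat.le_succ_iff.1 hj with hj | rfl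
      · exact (ih (by omega) j hj).trans (ht k (by omega)).le
      · exact le_rfl
  have hlt : ∀ j k, j < k → k < N → s j < s k := fun j k hjk hk =>
    ((hs1 j (hjk.trans hk)).2.trans_le (hmono k hk.le (j + 1) hjk)).trans (hs1 k hk).1
  have hclose : ∀ j k, j < k → k < N → s k - s j < 2 * π := fun j k hjk hk => by
    have h1 := (hs1 k hk).2.trans_le (hmono N le_rfl (k + 1) hk)
    have h2 := (hmono j (hjk.trans hk).le 0 (Nat.zero_le _)).trans_lt (hs1 j (hjk.trans hk)).1
    linarith
  have hne : ∀ j k, j < k → k < N →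
      toIcoMod two_pi_pos 0 (s j) ≠ toIcoMod two_pi_pos 0 (s k) := by
    intro j k hjk hk he
    obtain ⟨m, hm⟩ := (toIcoMod_eq_toIcoMod two_pi_pos).1 he
    rw [zsmul_eq_mul] at hm
    have h1 := hlt j k hjk hk
    have h2 := hclose j k hjk hk
    have hm0 : (0 : ℝ) < m := by
      by_contra hcon
      nlinarith [two_pi_pos]
    have hm1 : (m : ℝ) < 1 := by
      by_contra hcon
      nlinarith [two_pi_pos]
    norm_cast at hm0 hm1
    omega
  have hinj : InjOn (fun k => toIcoMod two_pi_pos 0 (s k)) (Iio N) := by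
    intro j hj k hk he
    rcases lt_trichotomy j k with h | h | h
    · exact absurd he (hne j k h hk)
    · exact h
    · exact absurd he.symm (hne k j h hj)
  calc (N : ℕ∞) = (Iio N).encard := by
        rw [← Finset.coe_Iio, encard_coe_eq_coe_finsetCard, Nat.card_Iio]
    _ = ((fun k => toIcoMod two_pi_pos 0 (s k)) '' Iio N).encard := hinj.encard_image.symm
    _ ≤ _ := by
        refine encard_le_encard ?_
        rintro _ ⟨k, hk, rfl⟩
        refine ⟨toIcoMod_mem_Ico' two_pi_pos _, ?_⟩
        change g (toIcoMod two_pi_pos 0 (s k)) = 0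
        rw [← self_sub_toIcoDiv_zsmul, hper.sub_zsmul_eq, hs2 k hk]

/-- The sum of the Fourier series `∑ (Re (a m) cos mx - Im (a m) sin mx)`. -/
noncomputable def reFourierSum (a : ℕ → ℂ) (x : ℝ) : ℝ :=
  (∑' m : ℕ, a m * Complex.exp (m * x * Complex.I)).re

/-- The sequence decays faster than any power. -/
def RapidDecay (a : ℕ → ℂ) : Prop :=
  ∀ k : ℕ, Summable fun m : ℕ => (m : ℝ) ^ k * ‖a m‖

theorem norm_exp_natCast_mul_I (m : ℕ) (x : ℝ) : ‖Complex.exp (m * x * Complex.I)‖ = 1 := by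
  exact_mod_cast Complex.norm_exp_ofReal_mul_I (m * x)

theorem RapidDecay.summable_norm {a : ℕ → ℂ} (ha : RapidDecay a) : Summable fun m => ‖a m‖ := by
  simpa using ha 0

theorem RapidDecay.summable {a : ℕ → ℂ} (ha : RapidDecay a) (x : ℝ) :
    Summable fun m : ℕ => a m * Complex.exp (m * x * Complex.I) :=
  Summable.of_norm (by simpa [norm_exp_natCast_mul_I] using ha.summable_norm)

theorem RapidDecay.mul_of_norm_le {a b : ℕ → ℂ} (ha : RapidDecay a) {C : ℝ}
    (hb : ∀ m, ‖b m‖ ≤ C * (1 + m)) : RapidDecay fun m => b m * a m := by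
  intro k
  have h : Summable fun m : ℕ => C * ((m : ℝ) ^ k * ‖a m‖ + (m : ℝ) ^ (k + 1) * ‖a m‖) :=
    ((ha k).add (ha (k + 1))).mul_left C
  refine h.of_nonneg_of_le (fun m => by positivity) fun m => ?_
  rw [norm_mul]
  calc (m : ℝ) ^ k * (‖b m‖ * ‖a m‖) ≤ (m : ℝ) ^ k * (C * (1 + m) * ‖a m‖) := by
        gcongr; exact hb m
    _ = _ := by ring

theorem RapidDecay.natCast_mul_I_mul {a : ℕ → ℂ} (ha : RapidDecay a) :
    RapidDecay fun m => (m * Complex.I) * a m :=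
  ha.mul_of_norm_le (C := 1) fun m => by simp

theorem RapidDecay.const_sub_mul {a : ℕ → ℂ} (ha : RapidDecay a) (lam : ℝ) :
    RapidDecay fun m => (lam - m * Complex.I) * a m :=
  ha.mul_of_norm_le (C := |lam| + 1) fun m => by
    refine (norm_sub_le _ _).trans ?_
    simp only [Complex.norm_real, norm_mul, Complex.norm_natCast, Complex.norm_I, mul_one,
      Real.norm_eq_abs]
    nlinarith [mul_nonneg (abs_nonneg lam) (Nat.cast_nonneg (α := ℝ) m)]

theorem reFourierSum_periodic (a : ℕ → ℂ) : Function.Periodic (reFourierSum a) (2 * π) := by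
  intro x
  unfold reFourierSum
  congr 2
  ext m
  congr 1
  have : (m * ((x + 2 * π : ℝ) : ℂ) * Complex.I)
      = m * x * Complex.I + m * (2 * π * Complex.I) := by push_cast; ring
  rw [this, Complex.exp_add, Complex.exp_nat_mul_two_pi_mul_I, mul_one]

theorem hasDerivAt_reFourierSum {a : ℕ → ℂ} (ha : RapidDecay a) (x : ℝ) :
    HasDerivAt (reFourierSum a) (reFourierSum (fun m => (m * Complex.I) * a m) x) x := by
  have h : HasDerivAt (fun y : ℝ => ∑' m : ℕ, a m * Complex.exp (m * y * Complex.I))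
      (∑' m : ℕ, (m * Complex.I) * a m * Complex.exp (m * x * Complex.I)) x := by
    refine hasDerivAt_tsum (y₀ := 0) ha.natCast_mul_I_mul.summable_norm
      (g := fun (m : ℕ) (y : ℝ) => a m * Complex.exp (m * y * Complex.I))
      (g' := fun (m : ℕ) (y : ℝ) => (m * Complex.I) * a m * Complex.exp (m * y * Complex.I))
      (fun m y => ?_) (fun m y => ?_) (ha.summable 0) x
    · have h1 : HasDerivAt (fun y : ℝ => (m * y * Complex.I : ℂ)) (m * 1 * Complex.I) y :=
        (((hasDerivAt_id y).ofReal_comp).const_mul (m : ℂ)).mul_const Complex.I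
      convert! h1.cexp.const_mul (a m) using 1
      ring
    · rw [norm_mul, norm_exp_natCast_mul_I, mul_one]
  exact Complex.reCLM.hasFDerivAt.comp_hasDerivAt x h

theorem iteratedDeriv_reFourierSum {a : ℕ → ℂ} (ha : RapidDecay a) (k : ℕ) :
    RapidDecay (fun m => (m * Complex.I) ^ k * a m) ∧
      iteratedDeriv k (reFourierSum a) = reFourierSum fun m => (m * Complex.I) ^ k * a m := by
  induction k with
  | zero => simpa using ha
  | succ k ih =>
    have heq : (fun m : ℕ => (m * Complex.I) ^ (k + 1) * a m)
        = fun m : ℕ => (m * Complex.I) * ((m * Complex.I) ^ k * a m) := by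
      ext m; ring
    rw [heq, iteratedDeriv_succ, ih.2]
    exact ⟨ih.1.natCast_mul_I_mul, funext fun x => (hasDerivAt_reFourierSum ih.1 x).deriv⟩

theorem reFourierSum_const_mul (c : ℝ) (a : ℕ → ℂ) (x : ℝ) :
    reFourierSum (fun m => c * a m) x = c * reFourierSum a x := by
  simp only [reFourierSum, mul_assoc, tsum_mul_left, Complex.re_ofReal_mul]

theorem AlternatesOnPeriod.reFourierSum_const_sub_mul {N : ℕ} (hN : Even N) {a : ℕ → ℂ}
    (ha : RapidDecay a) (lam : ℝ) (h : AlternatesOnPeriod N (reFourierSum a)) :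
    AlternatesOnPeriod N (reFourierSum fun m => (lam - m * Complex.I) * a m) := by
  convert h.const_mul_sub_deriv hN (hasDerivAt_reFourierSum ha) (reFourierSum_periodic _)
    (reFourierSum_periodic _) lam using 1
  ext x
  rw [← reFourierSum_const_mul]
  unfold reFourierSum
  rw [← Complex.sub_re, ← Summable.tsum_sub _ (ha.natCast_mul_I_mul.summable x)]
  · congr 2
    ext m
    ring
  · simpa only [mul_assoc] using (ha.summable x).mul_left (lam : ℂ)

/-- Powers of the operator `(D² - lam²)²`, whose symbol is `(lam² + m²)²`, do not decrease the
number of sign changes. -/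
theorem AlternatesOnPeriod.reFourierSum_sq_add_sq_pow_mul {N : ℕ} (hN : Even N) {a : ℕ → ℂ}
    (ha : RapidDecay a) (lam : ℝ) (h : AlternatesOnPeriod N (reFourierSum a)) (j : ℕ) :
    RapidDecay (fun m => ((lam : ℂ) ^ 2 + m ^ 2) ^ (2 * j) * a m) ∧
    AlternatesOnPeriod N (reFourierSum fun m => ((lam : ℂ) ^ 2 + m ^ 2) ^ (2 * j) * a m) := by
  induction j with
  | zero => simpa using ⟨ha, h⟩
  | succ j ih =>
    have heq : (fun m : ℕ => ((lam : ℂ) ^ 2 + m ^ 2) ^ (2 * (j + 1)) * a m) = fun m : ℕ =>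
        ((-lam : ℝ) - m * Complex.I) * ((lam - m * Complex.I) *
        (((-lam : ℝ) - m * Complex.I) * ((lam - m * Complex.I) *
          (((lam : ℂ) ^ 2 + m ^ 2) ^ (2 * j) * a m)))) := by
      ext m
      have : ((lam : ℂ) ^ 2 + m ^ 2) = (lam - m * Complex.I) * (lam + m * Complex.I) := by
        linear_combination (m : ℂ) ^ 2 * Complex.I_sq
      rw [mul_add, pow_add, mul_one, this]
      push_cast
      ring
    rw [heq]
    have d1 := ih.1.const_sub_mul lam
    have d2 := d1.const_sub_mul (-lam)
    have d3 := d2.const_sub_mul lam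
    exact ⟨d3.const_sub_mul (-lam), (((ih.2.reFourierSum_const_sub_mul hN ih.1 lam
      ).reFourierSum_const_sub_mul hN d1 (-lam)).reFourierSum_const_sub_mul hN d2 lam
      ).reFourierSum_const_sub_mul hN d3 (-lam)⟩

theorem two_mul_div_sq_add_sq_lt_one {x y : ℝ} (h : x ≠ y) : 2 * x * y / (x ^ 2 + y ^ 2) < 1 := by
  have h1 : 0 < (x - y) ^ 2 := by have := sub_ne_zero.2 h; positivity
  rcases (by positivity : 0 ≤ x ^ 2 + y ^ 2).eq_or_lt with h0 | h0
  · simp [← h0]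
  · rw [div_lt_one h0]; linarith

/-- Damping every mode but the `M`-th isolates that mode in the limit. -/
theorem tendsto_reFourierSum_damped {a : ℕ → ℂ} (ha : RapidDecay a) {M : ℕ} (hM : 0 < M) (x : ℝ) :
    Tendsto (fun k : ℕ => reFourierSum
      (fun m => ((2 * M * m / (M ^ 2 + m ^ 2) : ℝ) : ℂ) ^ k * a m) x) atTop
      (𝓝 (a M * Complex.exp (M * x * Complex.I)).re) := by
  have hr0 : ∀ m : ℕ, (0 : ℝ) ≤ 2 * M * m / (M ^ 2 + m ^ 2) := fun m => by positivity
  have hr1 : ∀ m : ℕ, m ≠ M → (2 * M * m / (M ^ 2 + m ^ 2) : ℝ) < 1 := fun m hm =>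
    two_mul_div_sq_add_sq_lt_one (by exact_mod_cast hm.symm)
  have hrM : (2 * M * M / (M ^ 2 + M ^ 2) : ℝ) = 1 := by
    field_simp; ring
  have hle : ∀ m : ℕ, (2 * M * m / (M ^ 2 + m ^ 2) : ℝ) ≤ 1 := fun m => by
    by_cases h : m = M
    · rw [h, hrM]
    · exact (hr1 m h).le
  have hlim : Tendsto (fun k : ℕ => ∑' m : ℕ, ((2 * M * m / (M ^ 2 + m ^ 2) : ℝ) : ℂ) ^ k * a m *
      Complex.exp (m * x * Complex.I)) atTop
      (𝓝 (∑' m : ℕ, if m = M then a m * Complex.exp (m * x * Complex.I) else 0)) := by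
    refine tendsto_tsum_of_dominated_convergence ha.summable_norm (fun m => ?_)
      (Eventually.of_forall fun k m => ?_)
    · by_cases h : m = M
      · subst h
        simp only [hrM, if_true]
        simp
      · rw [if_neg h]
        have h0 : Tendsto (fun k : ℕ => ((2 * M * m / (M ^ 2 + m ^ 2) : ℝ) : ℂ) ^ k) atTop (𝓝 0) :=
          tendsto_pow_atTop_nhds_zero_of_norm_lt_one (by
            rw [Complex.norm_real, Real.norm_of_nonneg (hr0 m)]
            exact hr1 m h)
        simpa using (h0.mul_const (a m)).mul_const (Complex.exp (m * x * Complex.I))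
    · rw [norm_mul, norm_mul, norm_exp_natCast_mul_I, mul_one, norm_pow, Complex.norm_real,
        Real.norm_of_nonneg (hr0 m)]
      exact mul_le_of_le_one_left (norm_nonneg _) (pow_le_one₀ (hr0 m) (hle m))
  rw [tsum_ite_eq] at hlim
  exact (Complex.continuous_re.tendsto _).comp hlim

theorem re_mul_exp_at_extremum (z : ℂ) {M : ℕ} (hM : 0 < M) (k : ℕ) :
    (z * Complex.exp (M * ((k * π - z.arg) / M : ℝ) * Complex.I)).re = (-1) ^ k * ‖z‖ := by
  have hM' : (M : ℂ) ≠ 0 := by exact_mod_cast hM.ne'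
  have h1 : (M * ((k * π - z.arg) / M : ℝ) * Complex.I : ℂ)
      = k * (π * Complex.I) - z.arg * Complex.I := by
    push_cast; field_simp
  rw [h1, Complex.exp_sub, Complex.exp_nat_mul, Complex.exp_pi_mul_I]
  have h2 : z = ‖z‖ * Complex.exp (z.arg * Complex.I) := (Complex.norm_mul_exp_arg_mul_I z).symm
  have h3 : z * ((-1) ^ k / Complex.exp (z.arg * Complex.I)) = (((-1) ^ k * ‖z‖ : ℝ) : ℂ) := by
    nth_rw 1 [h2]
    push_cast
    field_simp [Complex.exp_ne_zero]
  rw [h3, Complex.ofReal_re]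

/-- A nonzero `M`-th mode forces some high derivative to change sign `2M` times per period. -/
theorem exists_alternatesOnPeriod_iteratedDeriv {a : ℕ → ℂ} (ha : RapidDecay a) {M : ℕ}
    (hM : 0 < M) (haM : a M ≠ 0) :
    ∃ i, AlternatesOnPeriod (2 * M) (iteratedDeriv i (reFourierSum a)) := by
  set t : ℕ → ℝ := fun k => (k * π - (a M).arg) / M with ht
  have hM' : (0 : ℝ) < M := by exact_mod_cast hM
  have hev : ∀ᶠ k : ℕ in atTop, ∀ l ∈ Finset.range (2 * M + 1), 0 < (-1) ^ l * reFourierSum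
      (fun m => ((2 * M * m / (M ^ 2 + m ^ 2) : ℝ) : ℂ) ^ k * a m) (t l) := by
    rw [Filter.eventually_all_finset]
    intro l _
    have hl := (tendsto_reFourierSum_damped ha hM (t l)).const_mul ((-1) ^ l)
    refine hl.eventually_const_lt ?_
    rw [re_mul_exp_at_extremum _ hM, ← mul_assoc, ← mul_pow]
    simpa using haM
  obtain ⟨K, hK⟩ := eventually_atTop.1 hev
  have hdamp : RapidDecay fun m => ((2 * M * m / (M ^ 2 + m ^ 2) : ℝ) : ℂ) ^ (4 * K) * a m := by
    refine ha.mul_of_norm_le (C := 1) fun m => ?_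
    rw [norm_pow, Complex.norm_real, Real.norm_of_nonneg (by positivity)]
    have hle : (2 * M * m / (M ^ 2 + m ^ 2) : ℝ) ≤ 1 :=
      div_le_one_of_le₀ (by nlinarith [sq_nonneg ((M : ℝ) - m)]) (by positivity)
    have := pow_le_one₀ (n := 4 * K) (by positivity) hle
    have : (0 : ℝ) ≤ m := by positivity
    linarith
  have halt : AlternatesOnPeriod (2 * M)
      (reFourierSum fun m => ((2 * M * m / (M ^ 2 + m ^ 2) : ℝ) : ℂ) ^ (4 * K) * a m) := by
    refine ⟨t, fun k _ => ?_, ?_, fun k hk => hK (4 * K) (by omega) k (by simp; omega)⟩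
    · simp only [ht]
      gcongr
      linarith [pi_pos, (by push_cast; ring : ((k + 1 : ℕ) : ℝ) * π = k * π + π)]
    · simp only [ht]
      push_cast
      field_simp
      ring
  have hfin := (halt.reFourierSum_sq_add_sq_pow_mul (even_two_mul M) hdamp M (2 * K)).2
  refine ⟨4 * K, ?_⟩
  rw [(iteratedDeriv_reFourierSum ha (4 * K)).2]
  have hc : (0 : ℝ) < ((2 * M : ℝ) ^ (4 * K))⁻¹ := by positivity
  convert hfin.const_mul hc using 1
  ext x
  rw [← reFourierSum_const_mul]
  congr 1
  ext m
  have h1 : ((M : ℂ) ^ 2 + m ^ 2) ≠ 0 := by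
    have : (0 : ℝ) < (M : ℝ) ^ 2 + m ^ 2 := by positivity
    exact_mod_cast this.ne'
  have h2 : (2 * M : ℂ) ≠ 0 := by exact_mod_cast (by positivity : (2 * M : ℝ) ≠ 0)
  have hI : Complex.I ^ (4 * K) = 1 := by rw [pow_mul, Complex.I_pow_four, one_pow]
  rw [show 2 * (2 * K) = 4 * K by ring, mul_pow, hI, ← mul_assoc _ _ (a m), ← mul_pow]
  push_cast
  rw [mul_div_cancel₀ _ h1, mul_pow _ (m : ℂ), ← mul_assoc _ _ (a m),
    inv_mul_cancel_left₀ (pow_ne_zero _ h2), mul_one]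

/-- The unnormalized `m`-th Fourier coefficient over the period `[0, 2π]`. -/
noncomputable def periodIntegral (g : ℝ → ℝ) (m : ℤ) : ℂ :=
  ∫ x in (0 : ℝ)..2 * π, Complex.exp (-(m * x * Complex.I)) * g x

theorem periodIntegral_deriv {g g' : ℝ → ℝ} (hg : ∀ x, HasDerivAt g (g' x) x)
    (hg' : Continuous g') (hper : Function.Periodic g (2 * π)) (m : ℤ) :
    periodIntegral g' m = m * Complex.I * periodIntegral g m := by
  have hu : ∀ x : ℝ, HasDerivAt (fun x : ℝ => Complex.exp (-(m * x * Complex.I)))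
      (Complex.exp (-(m * x * Complex.I)) * -(m * 1 * Complex.I)) x := fun x =>
    ((((hasDerivAt_id x).ofReal_comp).const_mul (m : ℂ)).mul_const Complex.I).neg.cexp
  have h := intervalIntegral.integral_mul_deriv_eq_deriv_mul (a := 0) (b := 2 * π)
    (fun x _ => hu x) (fun x _ => (hg x).ofReal_comp)
    (Continuous.intervalIntegrable (by fun_prop) _ _)
    (Continuous.intervalIntegrable (by fun_prop) _ _)
  have h0 : g (2 * π) = g 0 := by simpa using hper 0
  have he : Complex.exp (-(m * (2 * π : ℝ) * Complex.I)) = 1 := by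
    have := Complex.exp_int_mul_two_pi_mul_I (-m)
    rw [← this]
    push_cast
    ring_nf
  unfold periodIntegral
  rw [h, he, h0, ← intervalIntegral.integral_const_mul]
  simp only [Complex.ofReal_zero, mul_zero, zero_mul, neg_zero, Complex.exp_zero, sub_self,
    zero_sub]
  rw [← intervalIntegral.integral_neg]
  congr 1
  ext x
  ring

theorem exists_norm_periodIntegral_le (g : ℝ → ℝ) :
    ∃ C, ∀ m, ‖periodIntegral g m‖ ≤ C := by
  refine ⟨∫ x in (0 : ℝ)..2 * π, |g x|, fun m => ?_⟩
  refine (intervalIntegral.norm_integral_le_integral_norm two_pi_pos.le).trans_eq ?_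
  congr 1
  ext x
  have : ‖Complex.exp (-(m * x * Complex.I))‖ = 1 := by
    have := Complex.norm_exp_ofReal_mul_I (-(m * x))
    rw [← this]
    push_cast
    ring_nf
  rw [norm_mul, this, one_mul, Complex.norm_real, Real.norm_eq_abs]

theorem Function.Periodic.iteratedDeriv {g : ℝ → ℝ} {c : ℝ} (h : Function.Periodic g c) (k : ℕ) :
    Function.Periodic (iteratedDeriv k g) c := by
  intro x
  rw [← congrFun (iteratedDeriv_comp_add_const k g c) x, h.funext]

theorem periodIntegral_iteratedDeriv {f : ℝ → ℝ} (hf : ContDiff ℝ (⊤ : ℕ∞) f)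
    (hper : Function.Periodic f (2 * π)) (k : ℕ) (m : ℤ) :
    periodIntegral (iteratedDeriv k f) m = (m * Complex.I) ^ k * periodIntegral f m := by
  induction k with
  | zero => simp
  | succ k ih =>
    have hd : ∀ x, HasDerivAt (iteratedDeriv k f) (iteratedDeriv (k + 1) f x) x := fun x => by
      rw [iteratedDeriv_succ]
      exact (hf.differentiable_iteratedDeriv k
        (by exact_mod_cast WithTop.coe_lt_top _) x).hasDerivAt
    rw [periodIntegral_deriv hd (hf.continuous_iteratedDeriv (k + 1) (by exact_mod_cast le_top))
      (hper.iteratedDeriv k), ih]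
    ring

theorem summable_pow_mul_norm_periodIntegral {f : ℝ → ℝ} (hf : ContDiff ℝ (⊤ : ℕ∞) f)
    (hper : Function.Periodic f (2 * π)) (k : ℕ) :
    Summable fun m : ℤ => |(m : ℝ)| ^ k * ‖periodIntegral f m‖ := by
  obtain ⟨C, hC⟩ := exists_norm_periodIntegral_le (iteratedDeriv (k + 2) f)
  refine Summable.of_norm_bounded_eventually
    (((Real.summable_one_div_int_pow (p := 2)).2 one_lt_two).mul_left C) ?_
  filter_upwards [(Set.finite_singleton (0 : ℤ)).compl_mem_cofinite] with m hm
  have hm0 : (m : ℝ) ≠ 0 := by exact_mod_cast hm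
  have h := hC m
  rw [periodIntegral_iteratedDeriv hf hper, norm_mul, norm_pow, norm_mul, Complex.norm_I, mul_one,
    Complex.norm_intCast, pow_add, sq_abs] at h
  rw [Real.norm_of_nonneg (by positivity), mul_one_div, le_div_iff₀ (by positivity)]
  linarith

theorem hasSum_periodIntegral {f : ℝ → ℝ} (hf : ContDiff ℝ (⊤ : ℕ∞) f)
    (hper : Function.Periodic f (2 * π)) (x : ℝ) :
    HasSum (fun m : ℤ => (1 / (2 * π) : ℂ) * periodIntegral f m * Complex.exp (m * x * Complex.I))
      (f x) := by
  have : Fact (0 < 2 * π) := ⟨two_pi_pos⟩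
  have hpi : (π : ℂ) ≠ 0 := by exact_mod_cast pi_ne_zero
  have hperC : Function.Periodic (fun x => (f x : ℂ)) (2 * π) := fun x => by
    simp only [hper x]
  let F : C(AddCircle (2 * π), ℂ) := ⟨hperC.lift, by
    refine continuous_coinduced_dom.2 ?_
    have := hf.continuous
    change Continuous fun x => (f x : ℂ)
    fun_prop⟩
  have hcoeff : ∀ m, fourierCoeff F m = (1 / (2 * π) : ℂ) * periodIntegral f m := by
    intro m
    rw [fourierCoeff_eq_intervalIntegral _ _ 0, zero_add, Complex.real_smul, periodIntegral]
    push_cast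
    congr 2
    ext y
    rw [fourier_coe_apply, smul_eq_mul]
    congr 2
    push_cast
    field_simp
  have hsum : Summable (fourierCoeff F) := by
    refine Summable.of_norm ?_
    simp only [hcoeff, norm_mul]
    exact (by simpa using summable_pow_mul_norm_periodIntegral hf hper 0 :
      Summable fun m : ℤ => ‖periodIntegral f m‖).mul_left _
  have h := has_pointwise_sum_fourier_series_of_summable hsum (x : AddCircle (2 * π))
  convert! h using 2 with m
  rw [hcoeff, fourier_coe_apply, smul_eq_mul]
  congr 2
  push_cast
  field_simp

theorem exists_eq_reFourierSum {f : ℝ → ℝ} (hf : ContDiff ℝ (⊤ : ℕ∞) f)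
    (hper : Function.Periodic f (2 * π)) :
    ∃ a : ℕ → ℂ, RapidDecay a ∧ f = reFourierSum a := by
  set c : ℤ → ℂ := fun m => (1 / (2 * π) : ℂ) * periodIntegral f m with hc
  have hdecay : ∀ k : ℕ, Summable fun m : ℤ => |(m : ℝ)| ^ k * ‖c m‖ := fun k => by
    refine ((summable_pow_mul_norm_periodIntegral hf hper k).mul_left ‖(1 / (2 * π) : ℂ)‖).congr
      fun m => ?_
    rw [hc, norm_mul]
    ring
  have hrapid : RapidDecay fun m => c m + if m = 0 then 0 else conj (c (-m)) := by
    intro k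
    have h1 := (hdecay k).comp_injective (i := fun m : ℕ => (m : ℤ)) Nat.cast_injective
    have h2 := (hdecay k).comp_injective (i := fun m : ℕ => -(m : ℤ))
      (neg_injective.comp Nat.cast_injective)
    refine (h1.add h2).of_nonneg_of_le (fun m => by positivity) fun m => ?_
    simp only [Function.comp, Int.cast_neg, Int.cast_natCast, abs_neg, Nat.abs_cast, ← mul_add]
    gcongr
    refine (norm_add_le _ _).trans ?_
    gcongr
    split_ifs <;> simp
  refine ⟨_, hrapid, ?_⟩
  ext x
  have h1 := (hasSum_periodIntegral hf hper x).nat_add_neg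
  have h2 := Complex.hasSum_re (h1.sub (hasSum_ite_eq (0 : ℕ) (c 0)))
  have hterm : ∀ m : ℕ, ((c m + if m = 0 then 0 else conj (c (-m))) *
      Complex.exp (m * x * Complex.I)).re = (c m * Complex.exp ((m : ℤ) * x * Complex.I) +
        c (-m) * Complex.exp ((-(m : ℤ) : ℤ) * x * Complex.I) - if m = 0 then c 0 else 0).re := by
    intro m
    rcases eq_or_ne m 0 with rfl | hm
    · simp
    · have he : Complex.exp ((-(m : ℤ) : ℤ) * x * Complex.I)
          = conj (Complex.exp (m * x * Complex.I)) := by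
        rw [← Complex.exp_conj]
        simp
      rw [he, if_neg hm, if_neg hm, sub_zero, Complex.add_re, Int.cast_natCast, add_mul,
        Complex.add_re]
      simp [Complex.mul_re]
  unfold reFourierSum
  rw [Complex.re_tsum (hrapid.summable x), tsum_congr hterm]
  convert h2.tsum_eq.symm using 1
  simp [hc]

/-- A smooth `2π`-periodic function all of whose derivatives have exactly `2n`
zeros in the period `[0, 2π)` (for a fixed positive integer `n`) is a
trigonometric polynomial. This is the consequence of the Pólya–Wiener theorem
for periodic analogs of `n`-nice functions. -/
theorem periodic_nice_is_trig_poly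
    (f : ℝ → ℝ) (hf : ContDiff ℝ (⊤ : ℕ∞) f)
    (hper : Function.Periodic f (2 * π))
    (n : ℕ) (hn : 0 < n)
    (hzeros : ∀ i : ℕ,
      {x ∈ Set.Ico (0 : ℝ) (2 * π) | iteratedDeriv i f x = 0}.encard
        = ((2 * n : ℕ) : ℕ∞)) :
    ∃ (m : ℕ) (a b : ℕ → ℝ), ∀ x : ℝ,
      f x = a 0 + ∑ k ∈ Finset.Icc 1 m,
        (a k * Real.cos (k * x) + b k * Real.sin (k * x)) := by
  obtain ⟨d, hd, hfd⟩ := exists_eq_reFourierSum hf hper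
  have hvanish : ∀ M, n < M → d M = 0 := by
    intro M hM
    by_contra hne
    obtain ⟨i, hi⟩ := exists_alternatesOnPeriod_iteratedDeriv hd (hn.trans hM) hne
    rw [← hfd] at hi
    have h := hi.le_encard_zeros (hf.continuous_iteratedDeriv i (by exact_mod_cast le_top))
      (hper.iteratedDeriv i)
    rw [hzeros i] at h
    have : 2 * M ≤ 2 * n := by exact_mod_cast h
    omega
  refine ⟨n, fun k => (d k).re, fun k => -(d k).im, fun x => ?_⟩
  rw [hfd, reFourierSum, tsum_eq_sum (s := Finset.range (n + 1)) (fun m hm => by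
    rw [hvanish m (by simpa using hm), zero_mul]), Finset.range_eq_Ico,
    Finset.sum_eq_sum_Ico_succ_bot (by omega), Complex.add_re, Complex.re_sum]
  congr 1
  · simp
  · refine Finset.sum_congr (by ext; simp) fun k _ => ?_
    have : (k * x * Complex.I : ℂ) = ((k * x : ℝ) : ℂ) * Complex.I := by push_cast; rfl
    rw [this, Complex.mul_re, Complex.exp_ofReal_mul_I_re, Complex.exp_ofReal_mul_I_im]
    ring
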